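/- Let G be a finite simple connected bipartite graph with n edges and let K be a field. If G has a cycle of length ≥ 6 having no chord, then the toric ideal I_{(A_G)^±} ⊆ K[x_1,…,x_{2n+1}] is not generated by quadratic binomials; that is, there is no set S of elements of the form m_1 − m_2, with m_1, m_2 monomials of degree 2, such that the ideal generated by S equals I_{(A_G)^±}. -/

import Mathlib

/-- The centrally symmetric configuration `A^± ∈ ℤ^{(d+1)×(2n+1)}` of `A ∈ ℤ^{d×n}`:
its columns are `(0,…,0,1)ᵀ` (column `0`), `(a_j, 1)ᵀ` (columns `1,…,n`) and
`(−a_j, 1)ᵀ` (columns `n+1,…,2n`). -/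
def csc {d n : ℕ} (A : Matrix (Fin d) (Fin n) ℤ) :
    Matrix (Fin (d + 1)) (Fin (2 * n + 1)) ℤ := fun i j =>
  if hi : (i : ℕ) < d then
    if h0 : (j : ℕ) = 0 then 0
    else if hj : (j : ℕ) ≤ n then A ⟨i, hi⟩ ⟨(j : ℕ) - 1, by omega⟩
    else - A ⟨i, hi⟩ ⟨(j : ℕ) - n - 1, by have := j.isLt; omega⟩
  else 1

/-- The incidence matrix `A_G ∈ ℤ^{d×n}` of a graph with edges `{v k, w k}`
(`v k < w k`): its `k`-th column is `ρ(e_k) = 𝐞_{v k} + 𝐞_{w k}`. -/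
def edgeMatrix {d n : ℕ} (v w : Fin n → Fin d) : Matrix (Fin d) (Fin n) ℤ :=
  Matrix.of fun i k => (if i = v k then (1 : ℤ) else 0) + (if i = w k then 1 else 0)

/-- The toric ideal `I_M ⊆ K[x_1,…,x_m]` of an integer matrix `M ∈ ℤ^{D×m}`: the
kernel of the `K`-algebra map to the Laurent polynomial ring (the group algebra of
`ℤ^D`) sending `x_j` to the Laurent monomial `t^{b_j}` given by the `j`-th column
`b_j` of `M`. -/
noncomputable def toricIdeal (K : Type*) [Field K] {D m : ℕ}
    (M : Matrix (Fin D) (Fin m) ℤ) : Ideal (MvPolynomial (Fin m) K) :=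
  RingHom.ker (MvPolynomial.aeval
    (fun j => (AddMonoidAlgebra.single (fun i => M i j) 1 :
      AddMonoidAlgebra K (Fin D → ℤ))) :
    MvPolynomial (Fin m) K →ₐ[K] AddMonoidAlgebra K (Fin D → ℤ))

/-- The column index of `(a_k, 1)ᵀ` in the centrally symmetric configuration. -/
def posIdx {n : ℕ} (k : Fin n) : Fin (2 * n + 1) := ⟨k + 1, by omega⟩

/-- The column index of `(−a_k, 1)ᵀ` in the centrally symmetric configuration. -/
def negIdx {n : ℕ} (k : Fin n) : Fin (2 * n + 1) := ⟨k + n + 1, by omega⟩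

lemma posIdx_injective {n : ℕ} : Function.Injective (posIdx (n := n)) := by
  intro a b h
  simp only [posIdx, Fin.mk.injEq] at h
  omega

lemma eq_zero_or_posIdx_or_negIdx {n : ℕ} (j : Fin (2 * n + 1)) :
    j = 0 ∨ (∃ k, j = posIdx k) ∨ ∃ k, j = negIdx k := by
  rcases j with ⟨j, hj⟩
  rcases Nat.eq_zero_or_pos j with h0 | h0
  · left; ext; simpa using h0
  · right
    by_cases h : j ≤ n
    · exact .inl ⟨⟨j - 1, by omega⟩, by simp only [posIdx, Fin.mk.injEq]; omega⟩
    · exact .inr ⟨⟨j - n - 1, by omega⟩, by simp only [negIdx, Fin.mk.injEq]; omega⟩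

section csc

variable {d n : ℕ} (A : Matrix (Fin d) (Fin n) ℤ)

lemma csc_castSucc_zero (i : Fin d) : csc A i.castSucc 0 = 0 := by
  simp [csc]

lemma csc_castSucc_posIdx (i : Fin d) (k : Fin n) : csc A i.castSucc (posIdx k) = A i k := by
  have : (k : ℕ) + 1 ≤ n := k.isLt
  simp [csc, posIdx, this]

lemma csc_castSucc_negIdx (i : Fin d) (k : Fin n) : csc A i.castSucc (negIdx k) = -A i k := by
  have : ¬ (k : ℕ) + n + 1 ≤ n := by omega
  have h : (k : ℕ) + n + 1 - n - 1 = k := by omega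
  simp [csc, negIdx, this, h]

lemma csc_last (j : Fin (2 * n + 1)) : csc A (Fin.last d) j = 1 := by
  simp [csc]

end csc

section edgeMatrix

variable {d n : ℕ} (v w : Fin n → Fin d)

lemma edgeMatrix_apply (i : Fin d) (k : Fin n) :
    edgeMatrix v w i k = (if i = v k then (1 : ℤ) else 0) + (if i = w k then 1 else 0) := rfl

lemma sum_edgeMatrix (k : Fin n) : ∑ i, edgeMatrix v w i k = 2 := by
  simp [edgeMatrix_apply, Finset.sum_add_distrib]

lemma sum_csc_posIdx (k : Fin n) : ∑ i : Fin d, csc (edgeMatrix v w) i.castSucc (posIdx k) = 2 := by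
  simp only [csc_castSucc_posIdx, sum_edgeMatrix]

lemma sum_csc_eq_two_or_nonpos (j : Fin (2 * n + 1)) :
    (∃ k, j = posIdx k) ∨ ∑ i : Fin d, csc (edgeMatrix v w) i.castSucc j ≤ 0 := by
  rcases eq_zero_or_posIdx_or_negIdx j with rfl | h | ⟨k, rfl⟩
  · simp [csc_castSucc_zero]
  · exact .inl h
  · simp [csc_castSucc_negIdx, sum_edgeMatrix]

/-- A sum of two columns of `(A_G)^±` equal to the sum of two positive columns consists of
positive columns. -/
lemma exists_posIdx_of_csc_add_eq {x y : Fin n} {j j' : Fin (2 * n + 1)}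
    (h : ∀ i, csc (edgeMatrix v w) i (posIdx x) + csc (edgeMatrix v w) i (posIdx y) =
      csc (edgeMatrix v w) i j + csc (edgeMatrix v w) i j') :
    (∃ k, j = posIdx k) ∧ ∃ k, j' = posIdx k := by
  have hs := Finset.sum_congr rfl fun (i : Fin d) (_ : i ∈ Finset.univ) => h i.castSucc
  simp only [Finset.sum_add_distrib, sum_csc_posIdx] at hs
  rcases sum_csc_eq_two_or_nonpos v w j with ⟨k, rfl⟩ | hj <;>
    rcases sum_csc_eq_two_or_nonpos v w j' with ⟨k', rfl⟩ | hj'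
  · exact ⟨⟨k, rfl⟩, k', rfl⟩
  all_goals try simp only [sum_csc_posIdx] at hs
  all_goals omega

end edgeMatrix

section toricIdeal

variable {K : Type*} [Field K] {D m : ℕ} {M : Matrix (Fin D) (Fin m) ℤ}

lemma X_mul_X_sub_mem_toricIdeal_iff {j₁ j₂ j₃ j₄ : Fin m} :
    (MvPolynomial.X j₁ * MvPolynomial.X j₂ - MvPolynomial.X j₃ * MvPolynomial.X j₄ :
      MvPolynomial (Fin m) K) ∈ toricIdeal K M ↔ ∀ i, M i j₁ + M i j₂ = M i j₃ + M i j₄ := by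
  simp only [toricIdeal, RingHom.mem_ker, map_sub, map_mul, MvPolynomial.aeval_X, sub_eq_zero,
    AddMonoidAlgebra.single_mul_single, mul_one]
  rw [AddMonoidAlgebra.single_left_inj one_ne_zero, funext_iff]
  rfl

lemma aeval_prod_X {ι : Type*} (s : Finset ι) (f : ι → Fin m) :
    MvPolynomial.aeval (fun j => (AddMonoidAlgebra.single (fun i => M i j) 1 :
      AddMonoidAlgebra K (Fin D → ℤ))) (∏ t ∈ s, MvPolynomial.X (R := K) (f t)) =
      AddMonoidAlgebra.single (∑ t ∈ s, fun i => M i (f t)) 1 := by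
  classical
  induction s using Finset.induction_on with
  | empty => rw [Finset.prod_empty, Finset.sum_empty, map_one, AddMonoidAlgebra.one_def]
  | insert a s ha ih =>
    rw [Finset.prod_insert ha, Finset.sum_insert ha, map_mul, ih, MvPolynomial.aeval_X,
      AddMonoidAlgebra.single_mul_single, mul_one]

lemma prod_X_sub_prod_X_mem_toricIdeal {ι : Type*} {s : Finset ι} {f g : ι → Fin m}
    (h : ∀ i, ∑ t ∈ s, M i (f t) = ∑ t ∈ s, M i (g t)) :
    (∏ t ∈ s, MvPolynomial.X (f t) - ∏ t ∈ s, MvPolynomial.X (g t) :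
      MvPolynomial (Fin m) K) ∈ toricIdeal K M := by
  have h' : ∑ t ∈ s, (fun i => M i (f t)) = ∑ t ∈ s, fun i => M i (g t) := by
    ext i
    simpa using h i
  rw [toricIdeal, RingHom.mem_ker, map_sub, sub_eq_zero]
  exact (aeval_prod_X s f).trans (h' ▸ (aeval_prod_X s g).symm)

end toricIdeal

lemma prod_X_eq_monomial {σ K ι : Type*} [CommSemiring K] (s : Finset ι) (f : ι → σ) :
    ∏ t ∈ s, MvPolynomial.X (R := K) (f t) =
      MvPolynomial.monomial (∑ t ∈ s, Finsupp.single (f t) 1) 1 := by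
  simp [MvPolynomial.monomial_sum_one, MvPolynomial.X]

/-- If no nonzero generator involves a monomial dividing `x^μ`, the coefficient of `x^μ`
vanishes on the ideal generated. -/
lemma coeff_eq_zero_of_mem_span_binomials {σ K : Type*} [Field K] {S : Set (MvPolynomial σ K)}
    {μ : σ →₀ ℕ} (hS : ∀ f ∈ S, f = 0 ∨ ∃ a b : σ →₀ ℕ,
      f = MvPolynomial.monomial a 1 - MvPolynomial.monomial b 1 ∧ ¬ a ≤ μ ∧ ¬ b ≤ μ)
    {g : MvPolynomial σ K} (hg : g ∈ Ideal.span S) : MvPolynomial.coeff μ g = 0 := by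
  induction hg using Submodule.closure_induction with
  | zero => exact MvPolynomial.coeff_zero μ
  | add x y _ _ hx hy => rw [MvPolynomial.coeff_add, hx, hy, add_zero]
  | smul_mem r f hf =>
    rcases hS f hf with rfl | ⟨a, b, rfl, ha, hb⟩
    · rw [smul_zero, MvPolynomial.coeff_zero]
    · rw [smul_eq_mul, mul_sub, MvPolynomial.coeff_sub, MvPolynomial.coeff_mul_monomial',
        MvPolynomial.coeff_mul_monomial', if_neg ha, if_neg hb, sub_zero]

/-- A degree-two monomial dividing the product of distinct variables `f t` is the product of two
of them. -/
lemma exists_ne_of_single_add_single_le {σ ι : Type*} {s : Finset ι} {f : ι → σ}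
    (hf : Set.InjOn f s) {a b : σ}
    (h : Finsupp.single a 1 + Finsupp.single b 1 ≤ ∑ t ∈ s, Finsupp.single (f t) 1) :
    ∃ x ∈ s, ∃ y ∈ s, x ≠ y ∧ f x = a ∧ f y = b := by
  classical
  have key : ∀ c, (∑ t ∈ s, Finsupp.single (f t) 1) c = (s.filter fun t => f t = c).card := by
    intro c
    simp [Finsupp.finsetSum_apply, Finsupp.single_apply]
  have hle : ∀ c, (s.filter fun t => f t = c).card ≤ 1 := by
    intro c
    rw [Finset.card_le_one]
    intro x hx y hy
    simp only [Finset.mem_filter] at hx hy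
    exact hf hx.1 hy.1 (hx.2.trans hy.2.symm)
  have ex : ∀ c, 1 ≤ (s.filter fun t => f t = c).card → ∃ x ∈ s, f x = c := by
    intro c hc
    obtain ⟨x, hx⟩ := Finset.card_pos.mp hc
    exact ⟨x, (Finset.mem_filter.mp hx).1, (Finset.mem_filter.mp hx).2⟩
  have ha := h a
  have hb := h b
  rw [key] at ha hb
  simp only [Finsupp.add_apply, Finsupp.single_apply, if_true] at ha hb
  obtain ⟨x, hx, hxa⟩ := ex a (by omega)
  obtain ⟨y, hy, hyb⟩ := ex b (by omega)
  refine ⟨x, hx, y, hy, ?_, hxa, hyb⟩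
  rintro rfl
  have := hle a
  have hab : b = a := hyb.symm.trans hxa
  simp only [hab, if_true] at ha
  omega

/-- In a cycle of length `2k ≥ 6` (vertices numbered `0, …, 2k-1`), the edges
`{2s, 2s+1}` and `{2t, 2t+1}` form the only pair of edges covering exactly their four ends. -/
lemma cycle_edges_eq_of_cover {k s t a b a' b' : ℕ} (hk : 3 ≤ k) (hst : s ≠ t)
    (hab : a + 1 = b ∨ b + 1 = a ∨ (a = 0 ∧ b + 1 = 2 * k) ∨ (b = 0 ∧ a + 1 = 2 * k))
    (hab' : a' + 1 = b' ∨ b' + 1 = a' ∨ (a' = 0 ∧ b' + 1 = 2 * k) ∨ (b' = 0 ∧ a' + 1 = 2 * k))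
    (ha : a = 2 * s ∨ a = 2 * s + 1 ∨ a = 2 * t ∨ a = 2 * t + 1)
    (hb : b = 2 * s ∨ b = 2 * s + 1 ∨ b = 2 * t ∨ b = 2 * t + 1)
    (h₁ : 2 * s = a ∨ 2 * s = b ∨ 2 * s = a' ∨ 2 * s = b')
    (h₂ : 2 * s + 1 = a ∨ 2 * s + 1 = b ∨ 2 * s + 1 = a' ∨ 2 * s + 1 = b')
    (h₃ : 2 * t = a ∨ 2 * t = b ∨ 2 * t = a' ∨ 2 * t = b')
    (h₄ : 2 * t + 1 = a ∨ 2 * t + 1 = b ∨ 2 * t + 1 = a' ∨ 2 * t + 1 = b') :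
    (s(a, b) = s(2 * s, 2 * s + 1) ∧ s(a', b') = s(2 * t, 2 * t + 1)) ∨
      (s(a, b) = s(2 * t, 2 * t + 1) ∧ s(a', b') = s(2 * s, 2 * s + 1)) := by
  simp only [Sym2.eq_iff]
  grind (splits := 30)

lemma exists_cycle_vertices {V : Type*} {G : SimpleGraph V} (hbip : G.Colorable 2)
    (hcyc : ∃ (a : V) (p : G.Walk a a), p.IsCycle ∧ 6 ≤ p.length ∧
      ∀ x y : V, x ∈ p.support → y ∈ p.support → G.Adj x y → s(x, y) ∈ p.edges) :
    ∃ (k : ℕ) (c : ℕ → V), 3 ≤ k ∧ Set.InjOn c (Set.Iio (2 * k)) ∧ c (2 * k) = c 0 ∧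
      (∀ i < 2 * k, G.Adj (c i) (c (i + 1))) ∧
      ∀ i < 2 * k, ∀ j < 2 * k, G.Adj (c i) (c j) →
        i + 1 = j ∨ j + 1 = i ∨ (i = 0 ∧ j + 1 = 2 * k) ∨ (j = 0 ∧ i + 1 = 2 * k) := by
  obtain ⟨a, p, hp, h6, hch⟩ := hcyc
  obtain ⟨k, hk⟩ := SimpleGraph.two_colorable_iff_forall_loop_even.mp hbip a p
  have hk : p.length = 2 * k := by omega
  have hinj : Set.InjOn p.getVert (Set.Iio (2 * k)) := fun i hi j hj h =>
    hp.getVert_injOn' (by simp only [Set.mem_Iio] at hi; simp only [Set.mem_ofPred_eq]; omega)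
      (by simp only [Set.mem_Iio] at hj; simp only [Set.mem_ofPred_eq]; omega) h
  have hlast : p.getVert (2 * k) = p.getVert 0 := by
    rw [← hk, p.getVert_length, p.getVert_zero]
  refine ⟨k, p.getVert, by omega, hinj, hlast,
    fun i hi => p.adj_getVert_succ (by omega), fun i hi j hj hadj => ?_⟩
  obtain ⟨m, hm, he⟩ := (SimpleGraph.Walk.mk_mem_edges_iff_exists p).mp
    (hch _ _ (p.getVert_mem_support i) (p.getVert_mem_support j) hadj)
  rw [hk] at hm
  have hmi : ∀ l < 2 * k, p.getVert m = p.getVert l → m = l := fun l hl h => hinj hm hl h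
  have hmi' : ∀ l < 2 * k, p.getVert (m + 1) = p.getVert l →
      m + 1 = l ∨ (m + 1 = 2 * k ∧ l = 0) := by
    intro l hl h
    rcases Nat.lt_or_ge (m + 1) (2 * k) with h' | h'
    · exact .inl (hinj h' hl h)
    · have h'' : m + 1 = 2 * k := by omega
      rw [h'', hlast] at h
      exact .inr ⟨h'', (hinj (Set.mem_Iio.mpr (by omega)) hl h).symm⟩
  rcases Sym2.eq_iff.mp he with ⟨h₁, h₂⟩ | ⟨h₁, h₂⟩
  · have := hmi i hi h₁
    have := hmi' j hj h₂
    omega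
  · have := hmi j hj h₁
    have := hmi' i hi h₂
    omega

lemma edgeMatrix_apply_of_sym2_eq {d n : ℕ} {v w : Fin n → Fin d} {e : Fin n} {p q : Fin d}
    (h : s(v e, w e) = s(p, q)) (i : Fin d) :
    edgeMatrix v w i e = (if i = p then (1 : ℤ) else 0) + (if i = q then 1 else 0) := by
  rw [edgeMatrix_apply]
  rcases Sym2.eq_iff.mp h with ⟨h₁, h₂⟩ | ⟨h₁, h₂⟩
  · rw [h₁, h₂]
  · rw [h₁, h₂, add_comm]

/-- Among the edges of a graph containing a chordless cycle `c 0, …, c (2k-1)` with `2k ≥ 6`,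
only the edges `e (2s)` and `e (2t)` of the cycle cover exactly their four ends. -/
lemma eq_of_edgeMatrix_add_eq {d n k : ℕ} {v w : Fin n → Fin d} {c : ℕ → Fin d}
    {e : ℕ → Fin n} (hk : 3 ≤ k) (hc : Set.InjOn c (Set.Iio (2 * k)))
    (hedge : ∀ x y, s(v x, w x) = s(v y, w y) → x = y)
    (he : ∀ i < 2 * k, s(v (e i), w (e i)) = s(c i, c (i + 1)))
    (hch : ∀ x, ∀ i < 2 * k, ∀ j < 2 * k, v x = c i → w x = c j →
      i + 1 = j ∨ j + 1 = i ∨ (i = 0 ∧ j + 1 = 2 * k) ∨ (j = 0 ∧ i + 1 = 2 * k))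
    {s t : ℕ} (hs : s < k) (ht : t < k) (hst : s ≠ t) {x y : Fin n}
    (h : ∀ i, edgeMatrix v w i (e (2 * s)) + edgeMatrix v w i (e (2 * t)) =
      edgeMatrix v w i x + edgeMatrix v w i y) :
    (x = e (2 * s) ∧ y = e (2 * t)) ∨ (x = e (2 * t) ∧ y = e (2 * s)) := by
  have h' : ∀ i, _ := fun i => by
    have := h i
    rwa [edgeMatrix_apply_of_sym2_eq (he (2 * s) (by omega)),
      edgeMatrix_apply_of_sym2_eq (he (2 * t) (by omega)), edgeMatrix_apply, edgeMatrix_apply]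
      at this
  have hcov : ∀ i, (i = v x ∨ i = w x ∨ i = v y ∨ i = w y) →
      ∃ l, l < 2 * k ∧ i = c l ∧ (l = 2 * s ∨ l = 2 * s + 1 ∨ l = 2 * t ∨ l = 2 * t + 1) := by
    intro i hi
    by_cases h1 : i = c (2 * s)
    · exact ⟨_, by omega, h1, by omega⟩
    by_cases h2 : i = c (2 * s + 1)
    · exact ⟨_, by omega, h2, by omega⟩
    by_cases h3 : i = c (2 * t)
    · exact ⟨_, by omega, h3, by omega⟩
    by_cases h4 : i = c (2 * t + 1)
    · exact ⟨_, by omega, h4, by omega⟩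
    have := h' i
    rw [if_neg h1, if_neg h2, if_neg h3, if_neg h4] at this
    rcases hi with hi | hi | hi | hi <;> rw [if_pos hi] at this <;>
      split_ifs at this <;> exact absurd this (by norm_num)
  obtain ⟨a, hak, hva, ha⟩ := hcov (v x) (by simp)
  obtain ⟨b, hbk, hwb, hb⟩ := hcov (w x) (by simp)
  obtain ⟨a', hak', hva', -⟩ := hcov (v y) (by simp)
  obtain ⟨b', hbk', hwb', -⟩ := hcov (w y) (by simp)
  have hcov' : ∀ l < 2 * k, (l = 2 * s ∨ l = 2 * s + 1 ∨ l = 2 * t ∨ l = 2 * t + 1) →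
      l = a ∨ l = b ∨ l = a' ∨ l = b' := by
    intro l hl hl'
    have hl'' : c l = c (2 * s) ∨ c l = c (2 * s + 1) ∨ c l = c (2 * t) ∨
        c l = c (2 * t + 1) := by
      rcases hl' with rfl | rfl | rfl | rfl <;> simp
    by_contra! hne
    have hcne : ∀ m < 2 * k, l ≠ m → c l ≠ c m := fun m hm hlm hcc => hlm (hc hl hm hcc)
    have := h' (c l)
    rw [hva, hwb, hva', hwb', if_neg (hcne a hak hne.1), if_neg (hcne b hbk hne.2.1),
      if_neg (hcne a' hak' hne.2.2.1), if_neg (hcne b' hbk' hne.2.2.2)] at this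
    rcases hl'' with hl'' | hl'' | hl'' | hl'' <;> rw [if_pos hl''] at this <;>
      split_ifs at this <;> exact absurd this (by norm_num)
  rcases cycle_edges_eq_of_cover hk hst (hch x a hak b hbk hva hwb)
    (hch y a' hak' b' hbk' hva' hwb') ha hb (hcov' _ (by omega) (by simp))
    (hcov' _ (by omega) (by simp)) (hcov' _ (by omega) (by simp))
    (hcov' _ (by omega) (by simp)) with ⟨h₁, h₂⟩ | ⟨h₁, h₂⟩
  · refine .inl ⟨hedge _ _ ?_, hedge _ _ ?_⟩
    · rw [he _ (by omega), hva, hwb]; exact congrArg (Sym2.map c) h₁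
    · rw [he _ (by omega), hva', hwb']; exact congrArg (Sym2.map c) h₂
  · refine .inr ⟨hedge _ _ ?_, hedge _ _ ?_⟩
    · rw [he _ (by omega), hva, hwb]; exact congrArg (Sym2.map c) h₁
    · rw [he _ (by omega), hva', hwb']; exact congrArg (Sym2.map c) h₂

/-- **Corollary 4.3.** Let `G` be a finite simple connected bipartite graph whose
edges are `e_k = {v k, w k}`, `k = 1,…,n`, and let `K` be a field.  If `G` has a
cycle of length at least `6` with no chord, then the toric ideal `I_{(A_G)^±}` is
not generated by quadratic binomials. -/
theorem toricIdeal_csc_not_quadratic_of_chordless_cycle (K : Type*) [Field K]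
    (d n : ℕ) (G : SimpleGraph (Fin d)) (hG : G.Connected) (hbip : G.Colorable 2)
    (v w : Fin n → Fin d) (hlt : ∀ k, v k < w k)
    (hadj : ∀ k, G.Adj (v k) (w k))
    (hsurj : ∀ i j : Fin d, G.Adj i j →
      ∃ k, (v k = i ∧ w k = j) ∨ (v k = j ∧ w k = i))
    (hinj : Function.Injective fun k => (v k, w k))
    (hcyc : ∃ (a : Fin d) (p : G.Walk a a), p.IsCycle ∧ 6 ≤ p.length ∧
      ∀ x y : Fin d, x ∈ p.support → y ∈ p.support → G.Adj x y →
        s(x, y) ∈ p.edges) :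
    ¬ ∃ S : Set (MvPolynomial (Fin (2 * n + 1)) K),
        (∀ f ∈ S, ∃ j₁ j₂ j₃ j₄ : Fin (2 * n + 1),
          f = MvPolynomial.X j₁ * MvPolynomial.X j₂ -
              MvPolynomial.X j₃ * MvPolynomial.X j₄) ∧
        Ideal.span S = toricIdeal K (csc (edgeMatrix v w)) := by
  rintro ⟨S, hS, hspan⟩
  obtain ⟨k, c, hk, hc, hclast, hcadj, hch⟩ := exists_cycle_vertices hbip hcyc
  have hedge : ∀ x y, s(v x, w x) = s(v y, w y) → x = y := by
    intro x y h
    rcases Sym2.eq_iff.mp h with ⟨h₁, h₂⟩ | ⟨h₁, h₂⟩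
    · exact hinj (Prod.ext h₁ h₂)
    · have hx := hlt x
      rw [h₁, h₂] at hx
      exact absurd hx (hlt y).asymm
  have hex : ∀ i, ∃ x, i < 2 * k → s(v x, w x) = s(c i, c (i + 1)) := by
    intro i
    by_cases hi : i < 2 * k
    · obtain ⟨x, hx⟩ := hsurj _ _ (hcadj i hi)
      exact ⟨x, fun _ => Sym2.eq_iff.mpr hx⟩
    · obtain ⟨x, -⟩ := hsurj _ _ (hcadj 0 (by omega))
      exact ⟨x, fun h => absurd h hi⟩
  choose e he using hex
  have hch' : ∀ x, ∀ i < 2 * k, ∀ j < 2 * k, v x = c i → w x = c j →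
      i + 1 = j ∨ j + 1 = i ∨ (i = 0 ∧ j + 1 = 2 * k) ∨ (j = 0 ∧ i + 1 = 2 * k) :=
    fun x i hi j hj h₁ h₂ => hch i hi j hj (h₁ ▸ h₂ ▸ hadj x)
  -- the even edges are distinct from each other and from the odd ones
  have hne : ∀ s < k, ∀ i < 2 * k, e (2 * s) = e i → i = 2 * s := by
    intro s hs i hi h
    have h' := he i hi
    rw [← h, he _ (by omega)] at h'
    have hi' : c i = c (2 * s) ∨ c i = c (2 * s + 1) := by
      rcases Sym2.eq_iff.mp h' with ⟨h₁, -⟩ | ⟨-, h₂⟩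
      exacts [.inl h₁.symm, .inr h₂.symm]
    rcases hi' with hi' | hi'
    · exact hc hi (Set.mem_Iio.mpr (by omega)) hi'
    · have hi'' := hc hi (Set.mem_Iio.mpr (by omega)) hi'
      subst hi''
      exfalso
      have h0 : c (2 * s + 1 + 1) = c (2 * s) := by
        rcases Sym2.eq_iff.mp h' with ⟨h₁, h₂⟩ | ⟨h₁, -⟩
        · exact h₂.symm.trans h₁.symm
        · exact h₁.symm
      rcases Nat.lt_or_ge (2 * s + 1 + 1) (2 * k) with hl | hl
      · have := hc hl (Set.mem_Iio.mpr (by omega)) h0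
        omega
      · rw [show 2 * s + 1 + 1 = 2 * k by omega, hclast] at h0
        have := hc (Set.mem_Iio.mpr (by omega)) (Set.mem_Iio.mpr (by omega)) h0
        omega
  let f : ℕ → Fin (2 * n + 1) := fun t => posIdx (e (2 * t))
  let g : ℕ → Fin (2 * n + 1) := fun t => posIdx (e (2 * t + 1))
  have hf : Set.InjOn f (Finset.range k) := by
    intro s hs t ht h
    simp only [Finset.coe_range, Set.mem_Iio] at hs ht
    have := hne s hs (2 * t) (by omega) (posIdx_injective h)
    omega
  let μ : Fin (2 * n + 1) →₀ ℕ := ∑ t ∈ Finset.range k, Finsupp.single (f t) 1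
  let ν : Fin (2 * n + 1) →₀ ℕ := ∑ t ∈ Finset.range k, Finsupp.single (g t) 1
  have hμν : ν ≠ μ := by
    intro h
    have h0 := DFunLike.congr_fun h (f 0)
    simp only [μ, ν, Finsupp.finsetSum_apply] at h0
    have hz : ∑ t ∈ Finset.range k, (Finsupp.single (g t) 1 : _ →₀ ℕ) (f 0) = 0 := by
      refine Finset.sum_eq_zero fun t ht => Finsupp.single_eq_of_ne fun hh => ?_
      rw [Finset.mem_range] at ht
      have := hne 0 (by omega) (2 * t + 1) (by omega) (posIdx_injective hh)
      omega
    rw [hz] at h0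
    have := (Finset.sum_eq_zero_iff.mp h0.symm) 0 (Finset.mem_range.mpr (by omega))
    simp at this
  have hmem : (∏ t ∈ Finset.range k, MvPolynomial.X (f t) -
      ∏ t ∈ Finset.range k, MvPolynomial.X (g t) : MvPolynomial (Fin (2 * n + 1)) K) ∈
      toricIdeal K (csc (edgeMatrix v w)) := by
    refine prod_X_sub_prod_X_mem_toricIdeal fun i => ?_
    refine Fin.lastCases ?_ (fun i => ?_) i
    · simp only [csc_last]
    · simp only [f, g, csc_castSucc_posIdx]
      rw [Finset.sum_congr rfl fun t ht => edgeMatrix_apply_of_sym2_eq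
          (he (2 * t) (by rw [Finset.mem_range] at ht; omega)) i,
        Finset.sum_congr rfl fun t ht => edgeMatrix_apply_of_sym2_eq
          (he (2 * t + 1) (by rw [Finset.mem_range] at ht; omega)) i,
        Finset.sum_add_distrib, Finset.sum_add_distrib, add_comm]
      congr 1
      have h₁ := Finset.sum_range_succ (fun t => if i = c (2 * t) then (1 : ℤ) else 0) k
      have h₂ := Finset.sum_range_succ' (fun t => if i = c (2 * t) then (1 : ℤ) else 0) k
      rw [h₁, hclast] at h₂
      exact add_right_cancel h₂
  have hcoeff := coeff_eq_zero_of_mem_span_binomials (μ := μ) ?_ (hspan ▸ hmem)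
  · rw [prod_X_eq_monomial, prod_X_eq_monomial, MvPolynomial.coeff_sub,
      MvPolynomial.coeff_monomial, MvPolynomial.coeff_monomial, if_pos rfl, if_neg hμν,
      sub_zero] at hcoeff
    exact one_ne_zero hcoeff
  have hquad : ∀ j₁ j₂ j₃ j₄ : Fin (2 * n + 1),
      (∀ i, csc (edgeMatrix v w) i j₁ + csc (edgeMatrix v w) i j₂ =
        csc (edgeMatrix v w) i j₃ + csc (edgeMatrix v w) i j₄) →
      Finsupp.single j₁ 1 + Finsupp.single j₂ 1 ≤ μ →
      (j₃ = j₁ ∧ j₄ = j₂) ∨ (j₃ = j₂ ∧ j₄ = j₁) := by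
    intro j₁ j₂ j₃ j₄ h hle
    obtain ⟨s, hs, t, ht, hst, rfl, rfl⟩ := exists_ne_of_single_add_single_le hf hle
    rw [Finset.mem_range] at hs ht
    obtain ⟨⟨x, rfl⟩, y, rfl⟩ := exists_posIdx_of_csc_add_eq v w h
    have h' : ∀ i, edgeMatrix v w i (e (2 * s)) + edgeMatrix v w i (e (2 * t)) =
        edgeMatrix v w i x + edgeMatrix v w i y := fun i => by
      simpa only [f, csc_castSucc_posIdx] using h i.castSucc
    rcases eq_of_edgeMatrix_add_eq hk hc hedge he hch' hs ht hst h' with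
      ⟨rfl, rfl⟩ | ⟨rfl, rfl⟩
    · exact .inl ⟨rfl, rfl⟩
    · exact .inr ⟨rfl, rfl⟩
  intro q hq
  obtain ⟨j₁, j₂, j₃, j₄, rfl⟩ := hS q hq
  have hbal := X_mul_X_sub_mem_toricIdeal_iff.mp (hspan ▸ Ideal.subset_span hq)
  by_cases h₁ : Finsupp.single j₁ 1 + Finsupp.single j₂ 1 ≤ μ
  · left
    rcases hquad _ _ _ _ hbal h₁ with ⟨rfl, rfl⟩ | ⟨rfl, rfl⟩ <;> ring
  by_cases h₂ : Finsupp.single j₃ 1 + Finsupp.single j₄ 1 ≤ μ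
  · left
    rcases hquad _ _ _ _ (fun i => (hbal i).symm) h₂ with ⟨rfl, rfl⟩ | ⟨rfl, rfl⟩ <;> ring
  exact .inr ⟨_, _, by simp [MvPolynomial.X, MvPolynomial.monomial_mul], h₁, h₂⟩
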